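/- arXiv:1412.1226 — 3 statements merged into one kernel-verified Lean document; each statement's English description precedes it below -/
import Mathlib

section
/- Let V be a real normed vector space, T > 0, N ∈ ℕ, δt := T/2^N and t_i := i·δt for i = 0,…,2^N. Let φ_real : [0,T] → V; let C₁ > 0, ε₁ ≥ 0, ε₂ ≥ 0. Suppose: (i) for each i ∈ {0,…,2^N−1} there is a map A_N(t_i) : V → V such that for every f ∈ V, sup_{t ∈ (t_i, t_{i+1}]} ‖φ_real(t) − A_N(t_i) f‖_V ≤ C₁·ε₁/2^N + ‖φ_real(t_i) − f‖_V; (ii) there is a subspace V_n ⊆ V and for each i a map A_{n,N}(t_i) : V_n → V_n such that for every f ∈ V and g ∈ V_n, ‖A_N(t_i) f − A_{n,N}(t_i) g‖_V ≤ ‖f − g‖_V + ε₂/2^N; (iii) f^{(n)} ∈ V_n satisfies ‖f^{(n)} − φ_real(0)‖_V ≤ ε₂. Define φ^{(n)}_N(t₀) := f^{(n)} and φ^{(n)}_N(t_{i+1}) := A_{n,N}(t_i) φ^{(n)}_N(t_i). Then ‖φ_real(0) − φ^{(n)}_N(t₀)‖_V ≤ ε₂, and for every i ∈ {0,…,2^N−1}: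 sup_{t ∈ (t_i, t_{i+1}]} ‖φ_real(t) − φ^{(n)}_N(t_{i+1})‖_V ≤ C₁·ε₁ + 2·ε₂. -/
/-- error bound for the time-discrete, spatially finite-dimensional
approximation of the signal (Theorem `signalapproximation`). -/
theorem stmt2
    {V : Type*} [NormedAddCommGroup V] [NormedSpace ℝ V]
    (T : ℝ) (hT : 0 < T) (N : ℕ)
    (t : ℕ → ℝ) (ht : ∀ i, t i = (i : ℝ) * (T / 2 ^ N))
    (φreal : ℝ → V)
    (C₁ ε₁ ε₂ : ℝ) (hC₁ : 0 < C₁) (hε₁ : 0 ≤ ε₁) (hε₂ : 0 ≤ ε₂)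
    -- (i) the one-step evolution operators A_N(t_i) : V → V
    (A : ℕ → V → V)
    (hA : ∀ i < 2 ^ N, ∀ f : V, ∀ τ ∈ Set.Ioc (t i) (t (i + 1)),
      ‖φreal τ - A i f‖ ≤ C₁ * ε₁ / 2 ^ N + ‖φreal (t i) - f‖)
    -- (ii) the finite-dimensional subspace V_n and the operators A_{n,N}(t_i) : V_n → V_n
    (Vn : Submodule ℝ V)
    (An : ℕ → V → V)
    (hAnmem : ∀ i < 2 ^ N, ∀ g ∈ Vn, An i g ∈ Vn)
    (hAn : ∀ i < 2 ^ N, ∀ f : V, ∀ g ∈ Vn, ‖A i f - An i g‖ ≤ ‖f - g‖ + ε₂ / 2 ^ N)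
    -- (iii) the approximate initial condition
    (fn : V) (hfnmem : fn ∈ Vn) (hfn : ‖fn - φreal 0‖ ≤ ε₂)
    -- the discretized signal φ^{(n)}_N
    (φn : ℕ → V) (hφn0 : φn 0 = fn)
    (hφnsucc : ∀ i < 2 ^ N, φn (i + 1) = An i (φn i)) :
    ‖φreal 0 - φn 0‖ ≤ ε₂ ∧
    ∀ i < 2 ^ N, ∀ τ ∈ Set.Ioc (t i) (t (i + 1)),
      ‖φreal τ - φn (i + 1)‖ ≤ C₁ * ε₁ + 2 * ε₂ := by
  have hstep : ∀ i < 2 ^ N, φn i ∈ Vn → ∀ τ ∈ Set.Ioc (t i) (t (i + 1)),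
      ‖φreal τ - φn (i + 1)‖ ≤ ‖φreal (t i) - φn i‖ + (C₁ * ε₁ + ε₂) / 2 ^ N := by
    intro i hi hmem τ hτ
    have h₁ := hA i hi (φreal (t i)) τ hτ
    have h₂ := hAn i hi (φreal (t i)) (φn i) hmem
    have h₃ := norm_sub_le_norm_sub_add_norm_sub (φreal τ) (A i (φreal (t i))) (An i (φn i))
    rw [sub_self, norm_zero] at h₁
    rw [hφnsucc i hi, add_div]
    linarith
  have hend : ∀ i, t (i + 1) ∈ Set.Ioc (t i) (t (i + 1)) := by
    intro i
    have hδ : 0 < T / 2 ^ N := by positivity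
    refine ⟨?_, le_rfl⟩
    rw [ht, ht]
    push_cast
    linarith
  have hinit : ‖φreal 0 - φn 0‖ ≤ ε₂ := by
    rwa [hφn0, norm_sub_rev]
  have hgrid : ∀ i ≤ 2 ^ N, φn i ∈ Vn ∧
      ‖φreal (t i) - φn i‖ ≤ ε₂ + i * ((C₁ * ε₁ + ε₂) / 2 ^ N) := by
    intro i
    induction i with
    | zero =>
      intro _
      have ht₀ : t 0 = 0 := by simp [ht]
      refine ⟨hφn0 ▸ hfnmem, ?_⟩
      simpa [ht₀] using hinit
    | succ i ih =>
      intro hi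
      obtain ⟨hmem, hle⟩ := ih (by omega)
      refine ⟨hφnsucc i hi ▸ hAnmem i hi _ hmem, ?_⟩
      have h := hstep i hi hmem _ (hend i)
      push_cast
      linarith
  refine ⟨hinit, fun i hi τ hτ => ?_⟩
  obtain ⟨hmem, hle⟩ := hgrid i hi.le
  have h := hstep i hi hmem τ hτ
  have hcast : (i : ℝ) + 1 ≤ 2 ^ N := by exact_mod_cast hi
  have hbound : ((i : ℝ) + 1) * ((C₁ * ε₁ + ε₂) / 2 ^ N) ≤ C₁ * ε₁ + ε₂ :=
    calc ((i : ℝ) + 1) * ((C₁ * ε₁ + ε₂) / 2 ^ N)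
        ≤ 2 ^ N * ((C₁ * ε₁ + ε₂) / 2 ^ N) := by gcongr
      _ = C₁ * ε₁ + ε₂ := by field_simp
  linarith
end

section
/- Let V be a real normed vector space, T > 0, N ∈ ℕ, t_i := i·T/2^N for i = 0,…,2^N, and let V_n ⊆ V be a subspace. Let φ_real : [0,T] → V, and for each i ∈ {0,…,2^N−1} let A_i : V × [t_i, t_{i+1}] → V satisfy: φ_real(t̃) = A_i(φ_real(t_i), t̃) for all t̃ ∈ [t_i, t_{i+1}]; A_i maps V_n × [t_i,t_{i+1}] into V_n; and ‖A_i(f, t̃) − A_i(g, t̃)‖_V ≤ M_N · ‖f − g‖_V for all f, g ∈ V and t̃ ∈ [t_i, t_{i+1}], where M_N ≥ 1 with M_N^{2^N} ≤ M for some M ≥ 1. Let ε₂ ≥ 0 and f^{(n)} ∈ V_n with ‖f^{(n)} − φ_real(0)‖_V ≤ ε₂, and define φ^{(n)}_N(0) := f^{(n)} and φ^{(n)}_N(t̃) := A_i(φ^{(n)}_N(t_i), t̃) for t̃ ∈ (t_i, t_{i+1}]. Then for every t̃ ∈ [0,T]: ‖φ_real(t̃) − φ^{(n)}_N(t̃)‖_V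 ≤ M · ε₂. -/
/-- Discrete Grönwall bound: two signals that follow the same `L`-Lipschitz one-step evolution
operators and start `ε`-close are `L ^ k * ε`-close up to time `t k`. -/
theorem norm_sub_le_pow_mul_of_lipschitz_evolution {V : Type*} [SeminormedAddCommGroup V]
    {t : ℕ → ℝ} (ht : Monotone t) {A : ℕ → V → ℝ → V} {L ε : ℝ} (hL : 1 ≤ L) (hε : 0 ≤ ε)
    {n : ℕ} {u v : ℝ → V}
    (hu : ∀ i < n, ∀ τ ∈ Set.Ioc (t i) (t (i + 1)), u τ = A i (u (t i)) τ)
    (hv : ∀ i < n, ∀ τ ∈ Set.Ioc (t i) (t (i + 1)), v τ = A i (v (t i)) τ)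
    (hA : ∀ i < n, ∀ f g : V, ∀ τ ∈ Set.Ioc (t i) (t (i + 1)),
      ‖A i f τ - A i g τ‖ ≤ L * ‖f - g‖)
    (h0 : ‖u (t 0) - v (t 0)‖ ≤ ε) {k : ℕ} (hk : k ≤ n) :
    ∀ τ ∈ Set.Icc (t 0) (t k), ‖u τ - v τ‖ ≤ L ^ k * ε := by
  induction k with
  | zero =>
    rintro τ ⟨h₁, h₂⟩
    obtain rfl := le_antisymm h₂ h₁
    simpa using h0
  | succ k ih =>
    rintro τ ⟨h₁, h₂⟩
    have ih := ih (by omega)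
    rcases le_or_gt τ (t k) with h | h
    · calc ‖u τ - v τ‖ ≤ L ^ k * ε := ih τ ⟨h₁, h⟩
        _ ≤ L ^ (k + 1) * ε := by gcongr; omega
    · rw [hu k hk τ ⟨h, h₂⟩, hv k hk τ ⟨h, h₂⟩]
      calc _ ≤ L * ‖u (t k) - v (t k)‖ := hA k hk _ _ τ ⟨h, h₂⟩
        _ ≤ L * (L ^ k * ε) := by
          gcongr
          exact ih (t k) ⟨ht (Nat.zero_le k), le_rfl⟩
        _ = L ^ (k + 1) * ε := by ring


/-- if each one-step evolution operator `A_i` is `M_N`-Lipschitz in its first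
argument with `M_N^{2^N} ≤ M`, then the simplified signal stays `M·ε₂`-close to the exact
signal on all of `[0,T]` (Lemma `lem:approx_bound`). -/
theorem stmt3
    {V : Type*} [NormedAddCommGroup V] [NormedSpace ℝ V]
    (T : ℝ) (hT : 0 < T) (N : ℕ)
    (t : ℕ → ℝ) (ht : ∀ i, t i = (i : ℝ) * (T / 2 ^ N))
    (Vn : Submodule ℝ V)
    (φreal : ℝ → V)
    (A : ℕ → V → ℝ → V)
    (M_N M : ℝ) (hMN1 : 1 ≤ M_N) (hM1 : 1 ≤ M) (hMNM : M_N ^ (2 ^ N) ≤ M)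
    -- the exact signal evolves by A_i on each subinterval
    (hexact : ∀ i < 2 ^ N, ∀ τ ∈ Set.Icc (t i) (t (i + 1)),
      φreal τ = A i (φreal (t i)) τ)
    -- A_i maps V_n × [t_i, t_{i+1}] into V_n
    (hmem : ∀ i < 2 ^ N, ∀ g ∈ Vn, ∀ τ ∈ Set.Icc (t i) (t (i + 1)), A i g τ ∈ Vn)
    -- Lipschitz continuity of A_i in the first argument, uniformly in time
    (hlip : ∀ i < 2 ^ N, ∀ f g : V, ∀ τ ∈ Set.Icc (t i) (t (i + 1)),
      ‖A i f τ - A i g τ‖ ≤ M_N * ‖f - g‖)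
    (ε₂ : ℝ) (hε₂ : 0 ≤ ε₂)
    (fn : V) (hfnmem : fn ∈ Vn) (hfn : ‖fn - φreal 0‖ ≤ ε₂)
    -- the simplified signal φ^{(n)}_N
    (φn : ℝ → V) (hφn0 : φn 0 = fn)
    (hφn : ∀ i < 2 ^ N, ∀ τ ∈ Set.Ioc (t i) (t (i + 1)), φn τ = A i (φn (t i)) τ) :
    ∀ τ ∈ Set.Icc (0 : ℝ) T, ‖φreal τ - φn τ‖ ≤ M * ε₂ := by
  have ht0 : t 0 = 0 := by simp [ht]
  have htT : t (2 ^ N) = T := by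
    rw [ht]
    push_cast
    field_simp
  have htm : Monotone t := fun i j hij => by
    rw [ht, ht]
    gcongr
  intro τ hτ
  have h := norm_sub_le_pow_mul_of_lipschitz_evolution htm hMN1 hε₂
    (fun i hi τ hτ => hexact i hi τ (Set.Ioc_subset_Icc_self hτ)) hφn
    (fun i hi f g τ hτ => hlip i hi f g τ (Set.Ioc_subset_Icc_self hτ))
    (by rwa [ht0, hφn0, norm_sub_rev]) le_rfl τ (by rwa [ht0, htT])
  exact h.trans (by gcongr)
end

section
/- Let n ∈ ℕ, C_L > 0, let L ∈ ℝ^{n×n} satisfy ‖L‖ ≤ 2·n·C_L, let D ∈ ℝ^{n×n} be symmetric positive definite, and set D'' := (I + δt·L) D (I + δt·L)ᵀ and D*⁻¹ := D⁻¹ − δt·(D⁻¹ L + Lᵀ D⁻¹). If 0 < δt < 1/(8·n·C_L·√(3·‖D⁻¹‖·‖D‖)), then D*⁻¹ is invertible, and its inverse D* satisfies ‖D* − D''‖ ≤ 288·‖D‖²·‖D⁻¹‖·n²·C_L²·(δt)². -/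
/-- The operator norm of an `n×n` real matrix, induced by the Euclidean norm on ℝⁿ. -/
noncomputable def opNorm {n : ℕ} (M : Matrix (Fin n) (Fin n) ℝ) : ℝ :=
  ‖(Matrix.toEuclideanCLM (𝕜 := ℝ) M :
      EuclideanSpace ℝ (Fin n) →L[ℝ] EuclideanSpace ℝ (Fin n))‖

open scoped Matrix.Norms.L2Operator in
theorem opNorm_eq_norm {n : ℕ} (M : Matrix (Fin n) (Fin n) ℝ) : opNorm M = ‖M‖ :=
  (Matrix.cstar_norm_def M).symm

theorem norm_mul_le_of_le_of_le {A : Type*} [NormedRing A] {x y : A} {r s : ℝ}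
    (hx : ‖x‖ ≤ r) (hy : ‖y‖ ≤ s) : ‖x * y‖ ≤ r * s :=
  (norm_mul_le x y).trans (mul_le_mul hx hy (norm_nonneg y) ((norm_nonneg x).trans hx))

/-- If `e * d = 1` and `a`, `b` are small, then `e - (e * a + b * e)` has a
right inverse which agrees with `(1 + a) * d * (1 + b)` to second order. -/
theorem exists_rightInverse_norm_sub_le {A : Type*} [NormedRing A] [NormOneClass A]
    [CompleteSpace A] {d e a b : A} {t : ℝ} (hed : e * d = 1)
    (ha : ‖a‖ ≤ t) (hb : ‖b‖ ≤ t) (ht : 48 * (‖e‖ * ‖d‖) * t ^ 2 ≤ 1) :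
    ∃ x, (e - (e * a + b * e)) * x = 1 ∧
      ‖x - (1 + a) * d * (1 + b)‖ ≤ 72 * ‖d‖ * (‖e‖ * ‖d‖) * t ^ 2 := by
  have ht0 : 0 ≤ t := (norm_nonneg a).trans ha
  have hκ : 1 ≤ ‖e‖ * ‖d‖ := by
    simpa [hed] using norm_mul_le e d
  have ht1 : t ≤ 1 := by nlinarith [sq_nonneg t]
  have hadd {c : A} (hc : ‖c‖ ≤ t) : ‖1 + c‖ ≤ 2 := by
    have := norm_add_le 1 c
    rw [norm_one] at this
    linarith
  set p := (1 + a) * d * (1 + b) with hp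
  set s := e * (a * a) * d * (1 + b) + b * e * a * d * (1 + b) + b * b with hs
  have hmp : (e - (e * a + b * e)) * p = 1 - s := by
    have hed' (y : A) : e * (d * y) = y := by rw [← mul_assoc, hed, one_mul]
    simp only [hp, hs, mul_add, add_mul, sub_mul, mul_assoc, one_mul, mul_one, hed, hed']
    abel
  have hs_norm : ‖s‖ ≤ 5 * (‖e‖ * ‖d‖) * t ^ 2 := by
    have h₁ : ‖e * (a * a) * d * (1 + b)‖ ≤ ‖e‖ * (t * t) * ‖d‖ * 2 := by
      apply_rules [norm_mul_le_of_le_of_le, le_refl, hadd]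
    have h₂ : ‖b * e * a * d * (1 + b)‖ ≤ t * ‖e‖ * t * ‖d‖ * 2 := by
      apply_rules [norm_mul_le_of_le_of_le, le_refl, hadd]
    have h₃ : ‖b * b‖ ≤ t * t := norm_mul_le_of_le_of_le hb hb
    have h₄ := norm_add₃_le (a := e * (a * a) * d * (1 + b))
      (b := b * e * a * d * (1 + b)) (c := b * b)
    nlinarith [mul_le_mul_of_nonneg_right hκ (sq_nonneg t)]
  have hs_small : ‖s‖ ≤ 5 / 48 := by linarith
  have hp_norm : ‖p‖ ≤ 2 * ‖d‖ * 2 :=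
    norm_mul_le_of_le_of_le (norm_mul_le_of_le_of_le (hadd ha) le_rfl) (hadd hb)
  obtain ⟨u, hu⟩ := isUnit_one_sub_of_norm_lt_one (x := s) (by linarith)
  set x := p * ↑u⁻¹ with hx
  have hxp : x - p = x * s := by
    have : x * (1 - s) = p := by rw [← hu, hx, mul_assoc, Units.inv_mul, mul_one]
    rw [← this]
    noncomm_ring
  have hx_norm : ‖x‖ ≤ 8 * ‖d‖ := by
    have h₁ : ‖x‖ ≤ ‖p‖ + ‖x - p‖ := by simpa using norm_add_le p (x - p)
    have h₂ : ‖x - p‖ ≤ ‖x‖ * (5 / 48) := hxp ▸ norm_mul_le_of_le_of_le le_rfl hs_small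
    linarith [norm_nonneg d]
  refine ⟨x, by rw [hx, ← mul_assoc, hmp, ← hu, Units.mul_inv], ?_⟩
  calc ‖x - p‖ ≤ 8 * ‖d‖ * (5 * (‖e‖ * ‖d‖) * t ^ 2) :=
        hxp ▸ norm_mul_le_of_le_of_le hx_norm hs_norm
    _ = 40 * (‖d‖ * (‖e‖ * ‖d‖) * t ^ 2) := by ring
    _ ≤ 72 * (‖d‖ * (‖e‖ * ‖d‖) * t ^ 2) := by gcongr; norm_num
    _ = 72 * ‖d‖ * (‖e‖ * ‖d‖) * t ^ 2 := by ring

open scoped Matrix.Norms.L2Operator in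
/-- with `D'' = (I + δt·L)D(I + δt·L)ᵀ` and
`D*⁻¹ = D⁻¹ − δt(D⁻¹L + LᵀD⁻¹)`, if `δt < 1/(8nC_L√(3‖D⁻¹‖‖D‖))` then `D*⁻¹` is
invertible and `‖D* − D''‖ ≤ 288‖D‖²‖D⁻¹‖n²C_L²(δt)²`
(Theorem `thm:further_approximation`, second part). -/
theorem stmt13
    (n : ℕ) (C_L δt : ℝ) (hCL : 0 < C_L)
    (L D : Matrix (Fin n) (Fin n) ℝ)
    (hL : opNorm L ≤ 2 * n * C_L) (hD : D.PosDef)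
    (D'' Dstarinv : Matrix (Fin n) (Fin n) ℝ)
    (hD'' : D'' = (1 + δt • L) * D * (1 + δt • L).transpose)
    (hDstarinv : Dstarinv = D⁻¹ - δt • (D⁻¹ * L + L.transpose * D⁻¹))
    (hδt0 : 0 < δt)
    (hδt : δt < 1 / (8 * n * C_L * Real.sqrt (3 * opNorm D⁻¹ * opNorm D))) :
    IsUnit Dstarinv ∧
    opNorm (Dstarinv⁻¹ - D'')
      ≤ 288 * opNorm D ^ 2 * opNorm D⁻¹ * (n : ℝ) ^ 2 * C_L ^ 2 * δt ^ 2 := by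
  obtain rfl | hn := n.eq_zero_or_pos
  · exact ⟨isUnit_of_subsingleton _, by simp [opNorm]⟩
  have : Nonempty (Fin n) := ⟨⟨0, hn⟩⟩
  simp only [opNorm_eq_norm] at *
  have hn' : (0 : ℝ) < n := mod_cast hn
  have hdet : IsUnit D.det := (Matrix.isUnit_iff_isUnit_det D).1 hD.isUnit
  have hκ : 0 < ‖D⁻¹‖ * ‖D‖ := by
    have := norm_mul_le D⁻¹ D
    rw [Matrix.nonsing_inv_mul D hdet, norm_one] at this
    linarith
  have ha : ‖δt • L‖ ≤ 2 * n * C_L * δt := by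
    rw [norm_smul, Real.norm_of_nonneg hδt0.le, mul_comm]
    gcongr
  have hb : ‖(δt • L).transpose‖ ≤ 2 * n * C_L * δt := by
    rwa [← Matrix.conjTranspose_eq_transpose_of_trivial, Matrix.l2_opNorm_conjTranspose]
  have ht : 48 * (‖D⁻¹‖ * ‖D‖) * (2 * n * C_L * δt) ^ 2 ≤ 1 := by
    have hs : 0 < Real.sqrt (3 * ‖D⁻¹‖ * ‖D‖) := Real.sqrt_pos.2 (by linarith)
    rw [lt_div_iff₀ (by positivity)] at hδt
    have hsq := pow_le_one₀ (n := 2) (by positivity) hδt.le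
    rw [mul_pow, mul_pow, Real.sq_sqrt (by positivity)] at hsq
    linarith
  have : CompleteSpace (Matrix (Fin n) (Fin n) ℝ) := FiniteDimensional.complete ℝ _
  obtain ⟨X, hX, hX_norm⟩ := exists_rightInverse_norm_sub_le
    (Matrix.nonsing_inv_mul D hdet) ha hb ht
  have hM : Dstarinv = D⁻¹ - (D⁻¹ * (δt • L) + (δt • L).transpose * D⁻¹) := by
    rw [hDstarinv, Matrix.transpose_smul, Matrix.mul_smul, Matrix.smul_mul, smul_add]
  rw [← hM] at hX
  refine ⟨IsUnit.of_mul_eq_one X hX, ?_⟩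
  rw [Matrix.inv_eq_right_inv hX, hD'', Matrix.transpose_add, Matrix.transpose_one]
  exact hX_norm.trans_eq (by ring)
end
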